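/- Let G₁ = N₁ ⋊ ⟨t₁⟩ and G₂ = N₂ ⋊ ⟨t₂⟩ be finitely presented groups, where ⟨t₁⟩ and ⟨t₂⟩ are infinite cyclic, and let H = {(g₁,g₂) ∈ G₁ × G₂ : k₁ = k₂, where g_i = n_i t_i^{k_i} with n_i ∈ N_i} be the fibre product associated to the isomorphism G₁/N₁ → G₂/N₂ sending t₁N₁ to t₂N₂. Then H is finitely presented if and only if: (i) N₁ is finitely generated, or N₂ is finitely generated; or (ii) there exist finitely generated subgroups B₁ ≤ N₁ and B₂ ≤ N₂ such that either (for both i = 1,2: t_iB_it_i⁻¹ is a proper subgroup of B_i and N_i = ⋃_{j≥0} t_i⁻ʲ B_i t_iʲ) or (for both i = 1,2: t_i⁻¹B_it_i is a proper subgroup of B_i and N_i = ⋃_{j≥0} t_iʲ B_i t_i⁻ʲ). -/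

import Mathlib

/-- A group is finitely presented if it is the quotient of a finitely generated free group
by the normal closure of finitely many relators. -/
def FinitelyPresentedGroup (G : Type*) [Group G] : Prop :=
  ∃ (n : ℕ) (f : FreeGroup (Fin n) →* G) (S : Finset (FreeGroup (Fin n))),
    Function.Surjective f ∧ f.ker = Subgroup.normalClosure (S : Set (FreeGroup (Fin n)))

namespace FibreCorank

open Multiplicative

theorem fp_iff (G : Type*) [Group G] :
    FinitelyPresentedGroup G ↔ Group.IsFinitelyPresented G := by
  constructor
  · rintro ⟨n, f, S, hf, hS⟩
    exact ⟨n, f, hf, S, S.finite_toSet, hS.symm⟩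
  · rintro ⟨n, f, hf, S, hS, h⟩
    refine ⟨n, f, hS.toFinset, hf, ?_⟩
    rw [hS.coe_toFinset]; exact h.symm

/-- the exponent homomorphism -/
theorem exists_kappa {G : Type*} [Group G] (N : Subgroup G) [N.Normal] (t : G)
    (ht : ¬ IsOfFinOrder t) (hsup : N ⊔ Subgroup.zpowers t = ⊤)
    (hinf : N ⊓ Subgroup.zpowers t = ⊥) :
    ∃ κ : G →* Multiplicative ℤ, κ t = ofAdd 1 ∧ κ.ker = N := by
  have h0 : ∀ k : ℤ, t ^ k ∈ N → k = 0 := by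
    intro k hk
    have h1 : t ^ k ∈ N ⊓ Subgroup.zpowers t := ⟨hk, k, rfl⟩
    rw [hinf, Subgroup.mem_bot] at h1
    by_contra hne
    exact ht (isOfFinOrder_iff_zpow_eq_one.2 ⟨k, hne, h1⟩)
  have h1 : ∀ g : G, ∃ k : ℤ, g * (t ^ k)⁻¹ ∈ N := by
    intro g
    have hg : g ∈ N ⊔ Subgroup.zpowers t := by rw [hsup]; trivial
    rw [Subgroup.mem_sup_of_normal_left] at hg
    obtain ⟨n, hn, z, ⟨k, rfl⟩, rfl⟩ := hg
    exact ⟨k, by simpa using hn⟩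
  choose κ hκ using h1
  have huniq : ∀ g k, g * (t ^ k)⁻¹ ∈ N → κ g = k := by
    intro g k hk
    have h2 := N.mul_mem (N.inv_mem (hκ g)) hk
    have h3 : (g * (t ^ κ g)⁻¹)⁻¹ * (g * (t ^ k)⁻¹) = t ^ (κ g - k) := by
      rw [zpow_sub]; group
    rw [h3] at h2
    have := h0 _ h2
    omega
  refine ⟨MonoidHom.mk' (fun g => ofAdd (κ g)) ?_, ?_, ?_⟩
  · intro a b
    rw [← ofAdd_add]
    congr 1
    apply huniq
    have h2 := (inferInstance : N.Normal).conj_mem _ (hκ b) (t ^ κ a)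
    have h3 := N.mul_mem (hκ a) h2
    convert h3 using 1
    rw [zpow_add]; group
  · simp only [MonoidHom.mk'_apply]
    rw [huniq t 1 (by simp)]
  · ext g
    rw [MonoidHom.mem_ker]
    simp only [MonoidHom.mk'_apply, ofAdd_eq_one]
    constructor
    · intro h; have := hκ g; rw [h] at this; simpa using this
    · intro h; exact huniq g 0 (by simpa using h)

section one
variable {G : Type*} [Group G] {κ : G →* Multiplicative ℤ} {t : G}

/-- exponent -/
def ex (κ : G →* Multiplicative ℤ) (g : G) : ℤ := (κ g).toAdd

/-- kernel part -/
def nu (κ : G →* Multiplicative ℤ) (t g : G) : G := g * t ^ (- ex κ g)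

theorem ex_mul (a b : G) : ex κ (a * b) = ex κ a + ex κ b := by simp [ex]
theorem ex_inv (a : G) : ex κ a⁻¹ = - ex κ a := by simp [ex]
theorem ex_one : ex κ 1 = 0 := by simp [ex]
theorem ex_zpow (a : G) (k : ℤ) : ex κ (a ^ k) = k * ex κ a := by simp [ex]
theorem ex_t (ht : κ t = ofAdd 1) : ex κ t = 1 := by simp [ex, ht]
theorem mem_ker_iff (g : G) : g ∈ κ.ker ↔ ex κ g = 0 := by
  simp [ex, MonoidHom.mem_ker]

theorem nu_mem (ht : κ t = ofAdd 1) (g : G) : nu κ t g ∈ κ.ker := by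
  rw [mem_ker_iff, nu, ex_mul, ex_zpow, ex_t ht]; ring

theorem nu_mul_zpow (g : G) : nu κ t g * t ^ ex κ g = g := by simp [nu]

theorem nu_mul (a b : G) :
    nu κ t (a * b) = nu κ t a * (t ^ ex κ a * nu κ t b * t ^ (- ex κ a)) := by
  simp only [nu, ex_mul, neg_add, zpow_add]
  group

theorem nu_inv (a : G) :
    nu κ t a⁻¹ = t ^ (- ex κ a) * (nu κ t a)⁻¹ * t ^ (ex κ a) := by
  simp only [nu, ex_inv]
  group

theorem nu_of_mem {a : G} (h : a ∈ κ.ker) : nu κ t a = a := by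
  rw [mem_ker_iff] at h; simp [nu, h]

theorem conj_mem_ker {a : G} (h : a ∈ κ.ker) (b : G) (k : ℤ) :
    b ^ k * a * b ^ (-k) ∈ κ.ker := by
  rw [mem_ker_iff] at *; simp [ex_mul, ex_zpow, ex_inv, h]

/-- the band of conjugates -/
def band (t : G) (X : Set G) (m : ℕ) : Set G :=
  {y | ∃ x ∈ X, ∃ j : ℤ, |j| ≤ m ∧ y = t ^ j * x * t ^ (-j)}

theorem band_finite (t : G) {X : Set G} (hX : X.Finite) (m : ℕ) : (band t X m).Finite := by
  have : (band t X m) ⊆ Set.image2 (fun x (j : ℤ) => t ^ j * x * t ^ (-j)) X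
      (Set.Icc (-(m : ℤ)) m) := by
    rintro y ⟨x, hx, j, hj, rfl⟩
    exact ⟨x, hx, j, abs_le.1 hj, rfl⟩
  exact (hX.image2 _ (Set.finite_Icc _ _)).subset this

theorem band_mono (t : G) (X : Set G) {m n : ℕ} (h : m ≤ n) : band t X m ⊆ band t X n := by
  rintro y ⟨x, hx, j, hj, rfl⟩
  exact ⟨x, hx, j, hj.trans (by exact_mod_cast h), rfl⟩

theorem conj_band {X : Set G} {m : ℕ} {y : G} (hy : y ∈ Subgroup.closure (band t X m)) (k : ℤ) :
    t ^ k * y * t ^ (-k) ∈ Subgroup.closure (band t X (m + k.natAbs)) := by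
  induction hy using Subgroup.closure_induction with
  | mem y hy =>
    obtain ⟨x, hx, j, hj, rfl⟩ := hy
    apply Subgroup.subset_closure
    refine ⟨x, hx, k + j, ?_, ?_⟩
    · push_cast
      have := abs_add_le k j
      linarith
    · rw [zpow_add, neg_add, zpow_add]; group
  | one => simp
  | mul a b _ _ ha hb =>
    have := Subgroup.mul_mem _ ha hb
    convert this using 1
    group
  | inv a _ ha =>
    have := Subgroup.inv_mem _ ha
    convert this using 1
    group

theorem exists_band {X : Set G} (ht : κ t = ofAdd 1) (hX : ∀ x ∈ X, x ∈ κ.ker)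
    (hgen : Subgroup.closure (insert t X) = ⊤) (g : G) :
    ∃ m, nu κ t g ∈ Subgroup.closure (band t X m) := by
  have hg : g ∈ Subgroup.closure (insert t X) := by rw [hgen]; trivial
  induction hg using Subgroup.closure_induction with
  | mem x hx =>
    rcases hx with rfl | hx
    · refine ⟨0, ?_⟩
      simp [nu, ex_t ht]
    · refine ⟨0, Subgroup.subset_closure ⟨x, hx, 0, by simp, ?_⟩⟩
      rw [nu_of_mem (hX x hx)]; simp
  | one => exact ⟨0, by simp [nu, ex_one]⟩
  | mul a b _ _ ha hb =>
    obtain ⟨m, hm⟩ := ha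
    obtain ⟨n, hn⟩ := hb
    refine ⟨m + (n + (ex κ a).natAbs), ?_⟩
    rw [nu_mul]
    refine Subgroup.mul_mem _ (Subgroup.closure_mono (band_mono t X (by omega)) hm) ?_
    exact Subgroup.closure_mono (band_mono t X (by omega)) (conj_band hn _)
  | inv a _ ha =>
    obtain ⟨m, hm⟩ := ha
    refine ⟨m + (- ex κ a).natAbs, ?_⟩
    rw [nu_inv]
    have := conj_band (Subgroup.inv_mem _ hm) (- ex κ a)
    simpa using this

theorem exists_band_finite {X Y : Set G} (ht : κ t = ofAdd 1) (hX : ∀ x ∈ X, x ∈ κ.ker)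
    (hgen : Subgroup.closure (insert t X) = ⊤) (hY : Y.Finite) (hYk : ∀ y ∈ Y, y ∈ κ.ker) :
    ∃ m, Y ⊆ Subgroup.closure (band t X m) := by
  induction Y, hY using Set.Finite.induction_on with
  | empty => exact ⟨0, by simp⟩
  | insert _ _ ih =>
    rename_i a s _ _
    obtain ⟨m, hm⟩ := ih (fun y hy => hYk y (Set.mem_insert_of_mem _ hy))
    obtain ⟨n, hn⟩ := exists_band ht hX hgen a
    rw [nu_of_mem (hYk a (Set.mem_insert _ _))] at hn
    refine ⟨m + n, Set.insert_subset ?_ (hm.trans ?_)⟩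
    · exact Subgroup.closure_mono (band_mono t X (by omega)) hn
    · exact Subgroup.closure_mono (band_mono t X (by omega))

/-- partial homomorphism data for an HNN extension -/
def Compat {E : Type*} [Group E] (t : G) (B : Subgroup G) (f : G → E) (τ : E) : Prop :=
  (∀ a ∈ B, ∀ b ∈ B, f (a * b) = f a * f b) ∧
  (∀ b ∈ B, t * b * t⁻¹ ∈ B → τ * f b * τ⁻¹ = f (t * b * t⁻¹))

theorem Compat.one {E : Type*} [Group E] {B : Subgroup G} {f : G → E} {τ : E}
    (h : Compat t B f τ) : f 1 = 1 := by
  have := h.1 1 B.one_mem 1 B.one_mem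
  simpa using this

theorem Compat.inv {E : Type*} [Group E] {B : Subgroup G} {f : G → E} {τ : E}
    (h : Compat t B f τ) {a : G} (ha : a ∈ B) : f a⁻¹ = (f a)⁻¹ := by
  have := h.1 a ha a⁻¹ (B.inv_mem ha)
  rw [mul_inv_cancel, h.one] at this
  exact eq_inv_of_mul_eq_one_right this.symm

theorem Compat.zpow {E : Type*} [Group E] {B : Subgroup G} {f : G → E} {τ : E}
    (h : Compat t B f τ) (k : ℤ) {b : G}
    (hb : ∀ j : ℤ, |j| ≤ |k| → t ^ j * b * t ^ (-j) ∈ B) :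
    τ ^ k * f b * τ ^ (-k) = f (t ^ k * b * t ^ (-k)) := by
  induction k using Int.induction_on with
  | zero => simp
  | succ i ih =>
    have h1 := ih (fun j hj => hb j (hj.trans (by
      rw [abs_of_nonneg (by positivity), abs_of_nonneg (by positivity)]; omega)))
    have e : t ^ ((i : ℤ) + 1) * b * t ^ (-((i : ℤ) + 1)) =
        t * (t ^ (i : ℤ) * b * t ^ (-(i : ℤ))) * t⁻¹ := by
      group
    have m1 : t ^ (i : ℤ) * b * t ^ (-(i : ℤ)) ∈ B := hb i (by
      rw [abs_of_nonneg (by positivity), abs_of_nonneg (by positivity)]; omega)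
    have m2 := hb ((i : ℤ) + 1) le_rfl
    rw [e] at m2 ⊢
    rw [← h.2 _ m1 m2, ← h1]
    group
  | pred i ih =>
    have habs : |(-(i : ℤ))| ≤ |(-(i : ℤ) - 1)| := by
      rw [abs_of_nonpos (by omega), abs_of_nonpos (by omega)]; omega
    have h1 := ih (fun j hj => hb j (hj.trans habs))
    have e : t ^ (-(i : ℤ)) * b * t ^ (-(-(i : ℤ))) =
        t * (t ^ (-(i : ℤ) - 1) * b * t ^ (-(-(i : ℤ) - 1))) * t⁻¹ := by
      group
    have m1 := hb (-(i : ℤ)) habs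
    have m2 := hb (-(i : ℤ) - 1) le_rfl
    rw [e] at m1 h1
    rw [← h.2 _ m2 m1] at h1
    have h2 : f (t ^ (-(i : ℤ) - 1) * b * t ^ (-(-(i : ℤ) - 1))) =
      τ⁻¹ * (τ ^ (-(i : ℤ)) * f b * τ ^ (-(-(i : ℤ)))) * τ := by rw [h1]; group
    rw [h2]; group

universe v

theorem key {α : Type*} (ht : κ t = ofAdd 1) (π : FreeGroup α →* G) (w : FreeGroup α) :
    ∃ Y : Set G, Y.Finite ∧ (∀ y ∈ Y, y ∈ κ.ker) ∧
      ∀ (E : Type v) [Group E] (B : Subgroup G) (f : G → E) (τ : E), Compat t B f τ → Y ⊆ B →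
      FreeGroup.lift (fun i => f (nu κ t (π (FreeGroup.of i))) * τ ^ ex κ (π (FreeGroup.of i))) w
        = f (nu κ t (π w)) * τ ^ ex κ (π w) := by
  have conjY : ∀ (b : G) (k : ℤ), b ∈ κ.ker →
      ∃ Y : Set G, Y.Finite ∧ (∀ y ∈ Y, y ∈ κ.ker) ∧
        ∀ j : ℤ, |j| ≤ |k| → t ^ j * b * t ^ (-j) ∈ Y := by
    intro b k hb
    refine ⟨(fun j : ℤ => t ^ j * b * t ^ (-j)) '' Set.Icc (-|k|) |k|,
      (Set.finite_Icc _ _).image _, ?_, ?_⟩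
    · rintro _ ⟨j, _, rfl⟩
      exact conj_mem_ker hb t j
    · intro j hj
      exact ⟨j, abs_le.1 hj, rfl⟩
  have invc : ∀ w : FreeGroup α, (∃ Y : Set G, Y.Finite ∧ (∀ y ∈ Y, y ∈ κ.ker) ∧
      ∀ (E : Type v) [Group E] (B : Subgroup G) (f : G → E) (τ : E), Compat t B f τ → Y ⊆ B →
      FreeGroup.lift (fun i => f (nu κ t (π (FreeGroup.of i))) * τ ^ ex κ (π (FreeGroup.of i))) w
        = f (nu κ t (π w)) * τ ^ ex κ (π w)) →
      (∃ Y : Set G, Y.Finite ∧ (∀ y ∈ Y, y ∈ κ.ker) ∧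
      ∀ (E : Type v) [Group E] (B : Subgroup G) (f : G → E) (τ : E), Compat t B f τ → Y ⊆ B →
      FreeGroup.lift (fun i => f (nu κ t (π (FreeGroup.of i))) * τ ^ ex κ (π (FreeGroup.of i))) w⁻¹
        = f (nu κ t (π w⁻¹)) * τ ^ ex κ (π w⁻¹)) := by
    rintro w ⟨Y, hY, hYk, h⟩
    obtain ⟨Z, hZ, hZk, hZm⟩ := conjY (nu κ t (π w))⁻¹ (- ex κ (π w))
      (inv_mem (nu_mem ht _))
    refine ⟨Y ∪ Z, hY.union hZ, ?_, ?_⟩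
    · rintro y (hy | hy)
      exacts [hYk y hy, hZk y hy]
    · intro E _ B f τ hc hsub
      have hmem : (nu κ t (π w))⁻¹ ∈ B := by
        have := hsub (Or.inr (hZm 0 (by simp)))
        simpa using this
      have h1 := hc.zpow (- ex κ (π w)) (b := (nu κ t (π w))⁻¹)
        (fun j hj => hsub (Or.inr (hZm j hj)))
      rw [map_inv, map_inv, h E B f τ hc (fun y hy => hsub (Or.inl hy)), nu_inv, ex_inv]
      rw [neg_neg] at h1
      rw [← h1]
      rw [hc.inv (by simpa using B.inv_mem hmem)]
      group
  induction w using FreeGroup.induction_on with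
  | C1 =>
    refine ⟨∅, Set.finite_empty, by simp, ?_⟩
    intro E _ B f τ hc _
    simp [nu, ex_one, hc.one]
  | of x =>
    refine ⟨∅, Set.finite_empty, by simp, ?_⟩
    intro E _ B f τ hc _
    simp
  | inv_of x ih => exact invc _ ih
  | mul a b ha hb =>
    obtain ⟨Y, hY, hYk, h⟩ := ha
    obtain ⟨Y', hY', hYk', h'⟩ := hb
    obtain ⟨Z, hZ, hZk, hZm⟩ := conjY (nu κ t (π b)) (ex κ (π a)) (nu_mem ht _)
    refine ⟨insert (nu κ t (π a)) (Y ∪ Y' ∪ Z), ((hY.union hY').union hZ).insert _, ?_, ?_⟩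
    · rintro y (rfl | (hy | hy) | hy)
      exacts [nu_mem ht _, hYk y hy, hYk' y hy, hZk y hy]
    · intro E _ B f τ hc hsub
      have h1 := hc.zpow (ex κ (π a)) (b := nu κ t (π b))
        (fun j hj => hsub (Or.inr (Or.inr (hZm j hj))))
      rw [map_mul, map_mul, h E B f τ hc (fun y hy => hsub (Or.inr (Or.inl (Or.inl hy)))),
        h' E B f τ hc (fun y hy => hsub (Or.inr (Or.inl (Or.inr hy)))), nu_mul, ex_mul,
        hc.1 _ (hsub (Or.inl rfl)) _ (hsub (Or.inr (Or.inr (hZm _ le_rfl)))), ← h1]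
      group

/-- Bieri-Strebel: a finitely presented group with a map onto `ℤ` is an HNN extension over an
arbitrarily large finitely generated base group. -/
theorem bieri_strebel [hfp : Group.IsFinitelyPresented G] (ht : κ t = ofAdd 1)
    (F : Set G) (hF : F.Finite) (hFk : ∀ x ∈ F, x ∈ κ.ker) :
    ∃ B : Subgroup G, B ≤ κ.ker ∧ B.FG ∧ F ⊆ B ∧ Subgroup.closure (insert t (B : Set G)) = ⊤ ∧
      ∀ (E : Type v) [Group E] (f : G → E) (τ : E), Compat t B f τ →
        ∃ g : G →* E, g t = τ ∧ ∀ b ∈ B, g b = f b := by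
  obtain ⟨n, π, hπ, S, hS, hker⟩ := hfp
  choose Y hYf hYk hY using fun w => key.{v} ht π w
  choose σ hσ using hπ
  let X : Set G := F ∪ Set.range (fun i => nu κ t (π (FreeGroup.of i)))
  have hXf : X.Finite := hF.union (Set.finite_range _)
  have hXk : ∀ x ∈ X, x ∈ κ.ker := by
    rintro x (hx | ⟨i, rfl⟩)
    exacts [hFk x hx, nu_mem ht _]
  have hXgen : Subgroup.closure (insert t X) = ⊤ := by
    rw [eq_top_iff]
    intro g _
    have : ∀ w, π w ∈ Subgroup.closure (insert t X) := by
      intro w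
      have hle : (⊤ : Subgroup (FreeGroup (Fin n))) ≤
          (Subgroup.closure (insert t X)).comap π := by
        rw [← FreeGroup.closure_range_of, Subgroup.closure_le]
        rintro _ ⟨i, rfl⟩
        change π _ ∈ Subgroup.closure (insert t X)
        rw [← nu_mul_zpow (κ := κ) (t := t) (π (FreeGroup.of i))]
        exact Subgroup.mul_mem _ (Subgroup.subset_closure (Or.inr (Or.inr ⟨i, rfl⟩)))
          (Subgroup.zpow_mem _ (Subgroup.subset_closure (Set.mem_insert _ _)) _)
      exact hle trivial
    rw [← hσ g]; exact this _
  let Z : Set G := (⋃ s ∈ S, Y s) ∪ (⋃ x ∈ X, Y (σ x)) ∪ Y (σ t)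
  have hZf : Z.Finite :=
    ((hS.biUnion fun s _ => hYf s).union (hXf.biUnion fun x _ => hYf _)).union (hYf _)
  have hZk : ∀ z ∈ Z, z ∈ κ.ker := by
    rintro z ((hz | hz) | hz)
    · simp only [Set.mem_iUnion] at hz
      obtain ⟨s, _, hz⟩ := hz
      exact hYk _ z hz
    · simp only [Set.mem_iUnion] at hz
      obtain ⟨s, _, hz⟩ := hz
      exact hYk _ z hz
    · exact hYk _ z hz
  obtain ⟨m, hm⟩ := exists_band_finite ht hXk hXgen hZf hZk
  have hXB : X ⊆ Subgroup.closure (band t X m) := by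
    intro x hx
    exact Subgroup.subset_closure ⟨x, hx, 0, by simp, by simp⟩
  refine ⟨Subgroup.closure (band t X m), ?_, ?_, fun x hx => hXB (Or.inl hx), ?_, ?_⟩
  · rw [Subgroup.closure_le]
    rintro _ ⟨x, hx, j, _, rfl⟩
    exact conj_mem_ker (hXk x hx) t j
  · exact (Subgroup.fg_iff _).2 ⟨_, rfl, band_finite t hXf m⟩
  · rw [eq_top_iff, ← hXgen]
    exact Subgroup.closure_mono (Set.insert_subset_insert hXB)
  · intro E _ f τ hc
    set φ : FreeGroup (Fin n) →* E :=
      FreeGroup.lift (fun i => f (nu κ t (π (FreeGroup.of i))) * τ ^ ex κ (π (FreeGroup.of i)))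
      with hφ
    have hrel : π.ker ≤ φ.ker := by
      rw [← hker]
      apply Subgroup.normalClosure_le_normal
      intro s hs
      have hs1 : π s = 1 := by
        have : s ∈ π.ker := by rw [← hker]; exact Subgroup.subset_normalClosure hs
        exact this
      have := hY s E _ f τ hc (fun y hy => hm (Or.inl (Or.inl (Set.mem_biUnion hs hy))))
      change φ s = 1
      rw [this, hs1]
      simp [nu, ex_one, hc.one]
    have hπ' : Function.Surjective π := fun g => ⟨σ g, hσ g⟩
    let g : G →* E := π.liftOfRightInverse σ hσ ⟨φ, hrel⟩
    have hg : ∀ w, g (π w) = φ w := fun w => by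
      exact MonoidHom.liftOfRightInverse_comp_apply π σ hσ ⟨φ, hrel⟩ w
    have hgt : g t = τ := by
      have h1 := hY (σ t) E _ f τ hc (fun y hy => hm (Or.inr hy))
      rw [← hφ, ← hg, hσ] at h1
      rw [h1]
      simp [nu, ex_t ht, hc.one]
    have hgx : ∀ x ∈ X, g x = f x := by
      intro x hx
      have h1 := hY (σ x) E _ f τ hc (fun y hy => hm (Or.inl (Or.inr (Set.mem_biUnion hx hy))))
      rw [← hφ, ← hg, hσ] at h1
      rw [h1, nu_of_mem (hXk x hx), (mem_ker_iff x).1 (hXk x hx)]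
      simp
    refine ⟨g, hgt, ?_⟩
    intro b hb
    induction hb using Subgroup.closure_induction with
    | mem y hy =>
      obtain ⟨x, hx, j, hj, rfl⟩ := hy
      rw [map_mul, map_mul, map_zpow, map_zpow, hgt, hgx x hx]
      apply hc.zpow
      intro i hi
      exact Subgroup.subset_closure ⟨x, hx, i, hi.trans hj, rfl⟩
    | one => rw [map_one, hc.one]
    | mul a b ha hb iha ihb => rw [map_mul, iha, ihb, hc.1 a ha b hb]
    | inv a ha iha => rw [map_inv, iha, hc.inv ha]

end one

section hnn
variable {Γ : Type*} [Group Γ] (τ : Γ) (B : Subgroup Γ)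

/-- elements of `B` conjugated into `B` by `τ` -/
def assoc : Subgroup B := (B.comap (MulAut.conj τ).toMonoidHom).subgroupOf B

theorem mem_assoc (b : B) : b ∈ assoc τ B ↔ τ * b * τ⁻¹ ∈ B := Iff.rfl

/-- conjugation between the associated subgroups -/
def assocEquiv : assoc τ B ≃* assoc τ⁻¹ B where
  toFun a := ⟨⟨τ * a * τ⁻¹, a.2⟩, by
    rw [mem_assoc]
    have : τ⁻¹ * (τ * (a : Γ) * τ⁻¹) * τ⁻¹⁻¹ = (a : Γ) := by group
    change τ⁻¹ * (τ * (a : Γ) * τ⁻¹) * τ⁻¹⁻¹ ∈ B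
    rw [this]
    exact a.1.2⟩
  invFun a := ⟨⟨τ⁻¹ * a * τ⁻¹⁻¹, a.2⟩, by
    rw [mem_assoc]
    have : τ * (τ⁻¹ * (a : Γ) * τ⁻¹⁻¹) * τ⁻¹ = (a : Γ) := by group
    change τ * (τ⁻¹ * (a : Γ) * τ⁻¹⁻¹) * τ⁻¹ ∈ B
    rw [this]
    exact a.1.2⟩
  left_inv a := by
    ext
    change τ⁻¹ * (τ * (a : Γ) * τ⁻¹) * τ⁻¹⁻¹ = (a : Γ)
    group
  right_inv a := by
    ext
    change τ * (τ⁻¹ * (a : Γ) * τ⁻¹⁻¹) * τ⁻¹ = (a : Γ)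
    group
  map_mul' a b := by
    ext
    change τ * ((a : Γ) * (b : Γ)) * τ⁻¹ = (τ * (a : Γ) * τ⁻¹) * (τ * (b : Γ) * τ⁻¹)
    group

theorem britton {G : Type*} [Group G] {A D : Subgroup G} (φ : A ≃* D) {x y : G}
    (hx : x ∉ A) (hy : y ∉ D)
    (hc : Commute (HNNExtension.t * HNNExtension.of x * HNNExtension.t⁻¹ :
      HNNExtension G A D φ) (HNNExtension.of y)) : False := by
  let w : HNNExtension.NormalWord.ReducedWord G A D :=
    { head := 1
      toList := [(1, x), (-1, y), (1, x⁻¹), (-1, y⁻¹)]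
      chain := by simp [hx, hy] }
  have hw : w.prod φ = 1 := by
    simp only [w, HNNExtension.NormalWord.ReducedWord.prod]
    simp
    have := hc.eq
    have h2 := mul_inv_eq_one.2 this
    simp only [mul_inv_rev, inv_inv] at h2
    simpa [mul_assoc] using h2
  have := HNNExtension.ReducedWord.toList_eq_nil_of_mem_of_range φ w
    (by rw [hw]; exact one_mem _)
  simp [w] at this

end hnn

section ker

/-- A surjection from a finitely generated group to a finitely presented one has a finitely
normally generated kernel. -/
theorem ker_fng {P H : Type*} [Group P] [Group H] [hP : Group.IsFinitelyPresented P]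
    [hH : Group.IsFinitelyPresented H] (Φ : P →* H) (hΦ : Function.Surjective Φ) :
    Φ.ker.IsFinitelyNormallyGenerated := by
  obtain ⟨n, ψ, hψ, -⟩ := hP
  obtain ⟨m, φ, hφ, S, hS, hker⟩ := hH
  choose r hr using hΦ
  choose l hl using hφ
  let σ : FreeGroup (Fin m) →* P := FreeGroup.lift fun i => r (φ (FreeGroup.of i))
  have hσ : ∀ w, Φ (σ w) = φ w := by
    intro w
    have : Φ.comp σ = φ := by
      ext i; simp [σ, hr]
    rw [← this]; rfl
  let x : Fin n → P := fun i => ψ (FreeGroup.of i)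
  let T : Set P := σ '' S ∪ Set.range fun i => x i * (σ (l (Φ (x i))))⁻¹
  refine ⟨T, (hS.image _).union (Set.finite_range _), le_antisymm ?_ ?_⟩
  · apply Subgroup.normalClosure_le_normal
    rintro _ (⟨s, hs, rfl⟩ | ⟨i, rfl⟩)
    · change Φ (σ s) = 1
      rw [hσ]
      have : s ∈ φ.ker := by rw [← hker]; exact Subgroup.subset_normalClosure hs
      exact this
    · change Φ (x i * (σ (l (Φ (x i))))⁻¹) = 1
      simp [hσ, hl]
  · have hσS : ∀ w, φ w = 1 → σ w ∈ Subgroup.normalClosure T := by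
      intro w hw
      have hle : φ.ker ≤ (Subgroup.normalClosure T).comap σ := by
        rw [← hker]
        apply Subgroup.normalClosure_le_normal
        intro s hs
        exact Subgroup.subset_normalClosure (Or.inl ⟨s, hs, rfl⟩)
      exact hle hw
    let q := QuotientGroup.mk' (Subgroup.normalClosure T)
    have hrange : ∀ p : P, ∃ w, q (σ w) = q p := by
      intro p
      obtain ⟨u, rfl⟩ := hψ p
      have hle : (⊤ : Subgroup (FreeGroup (Fin n))) ≤ ((q.comp σ).range).comap (q.comp ψ) := by
        rw [← FreeGroup.closure_range_of, Subgroup.closure_le]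
        rintro _ ⟨i, rfl⟩
        refine ⟨l (Φ (x i)), ?_⟩
        have h1 : x i * (σ (l (Φ (x i))))⁻¹ ∈ Subgroup.normalClosure T :=
          Subgroup.subset_normalClosure (Or.inr ⟨i, rfl⟩)
        have h2 : q (x i * (σ (l (Φ (x i))))⁻¹) = 1 := (QuotientGroup.eq_one_iff _).2 h1
        rw [map_mul, map_inv, mul_inv_eq_one] at h2
        exact h2.symm
      exact hle (Subgroup.mem_top u)
    intro p hp
    obtain ⟨w, hw⟩ := hrange p
    have h1 : q ((σ w)⁻¹ * p) = 1 := by rw [map_mul, map_inv, hw]; simp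
    have h2 : (σ w)⁻¹ * p ∈ Subgroup.normalClosure T := (QuotientGroup.eq_one_iff _).1 h1
    have h3 : (σ w)⁻¹ * p ∈ Φ.ker := by
      have hTk : Subgroup.normalClosure T ≤ Φ.ker := by
        apply Subgroup.normalClosure_le_normal
        rintro _ (⟨s, hs, rfl⟩ | ⟨i, rfl⟩)
        · change Φ (σ s) = 1
          rw [hσ]
          have : s ∈ φ.ker := by rw [← hker]; exact Subgroup.subset_normalClosure hs
          exact this
        · change Φ (x i * (σ (l (Φ (x i))))⁻¹) = 1
          simp [hσ, hl]
      exact hTk h2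
    have h4 : φ w = 1 := by
      rw [MonoidHom.mem_ker, map_mul, map_inv, hσ, (MonoidHom.mem_ker).1 hp] at h3
      simpa using h3
    have := Subgroup.mul_mem _ (hσS w h4) h2
    simpa using this

theorem finite_of_mem_ncl {P : Type*} [Group P] (T : Set P) {x : P}
    (hx : x ∈ Subgroup.normalClosure T) :
    ∃ T' ⊆ T, T'.Finite ∧ x ∈ Subgroup.normalClosure T' := by
  unfold Subgroup.normalClosure at hx
  induction hx using Subgroup.closure_induction with
  | mem y hy =>
    obtain ⟨a, ha, hay⟩ := Group.mem_conjugatesOfSet_iff.1 hy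
    refine ⟨{a}, by simpa using ha, Set.finite_singleton _, ?_⟩
    apply Subgroup.conjugatesOfSet_subset_normalClosure
    exact Group.mem_conjugatesOfSet_iff.2 ⟨a, rfl, hay⟩
  | one => exact ⟨∅, by simp, Set.finite_empty, one_mem _⟩
  | mul a b _ _ ha hb =>
    obtain ⟨T1, h1, h2, h3⟩ := ha
    obtain ⟨T2, h1', h2', h3'⟩ := hb
    exact ⟨T1 ∪ T2, Set.union_subset h1 h1', h2.union h2', mul_mem
      (Subgroup.normalClosure_mono Set.subset_union_left h3)
      (Subgroup.normalClosure_mono Set.subset_union_right h3')⟩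
  | inv a _ ha =>
    obtain ⟨T1, h1, h2, h3⟩ := ha
    exact ⟨T1, h1, h2, inv_mem h3⟩

theorem finite_ncl {P : Type*} [Group P] (T : Set P)
    (h : (Subgroup.normalClosure T).IsFinitelyNormallyGenerated) :
    ∃ T' ⊆ T, T'.Finite ∧ Subgroup.normalClosure T ≤ Subgroup.normalClosure T' := by
  obtain ⟨S, hS, h⟩ := h
  have hST : ∀ s : S, ∃ T' ⊆ T, T'.Finite ∧ (s : P) ∈ Subgroup.normalClosure T' := by
    rintro ⟨s, hs⟩
    exact finite_of_mem_ncl T (by rw [← h]; exact Subgroup.subset_normalClosure hs)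
  choose U hU1 hU2 hU3 using hST
  have : Finite S := hS
  refine ⟨⋃ s, U s, Set.iUnion_subset hU1, Set.finite_iUnion hU2, ?_⟩
  rw [← h]
  apply Subgroup.normalClosure_le_normal
  intro s hs
  exact Subgroup.normalClosure_mono (Set.subset_iUnion U ⟨s, hs⟩) (hU3 ⟨s, hs⟩)

end ker

section ascend
variable {G : Type*} [Group G] {κ : G →* Multiplicative ℤ} {t : G}

theorem asc_pow {B : Subgroup G} (hasc : ∀ b ∈ B, t * b * t⁻¹ ∈ B) (j : ℕ) {b : G} (hb : b ∈ B) :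
    t ^ j * b * (t ^ j)⁻¹ ∈ B := by
  induction j with
  | zero => simpa
  | succ j ih =>
    have := hasc _ ih
    convert this using 1
    rw [pow_succ']; group

theorem ascend_union (ht : κ t = ofAdd 1) {B : Subgroup G} (hB : B ≤ κ.ker)
    (hgen : Subgroup.closure (insert t (B : Set G)) = ⊤) (hasc : ∀ b ∈ B, t * b * t⁻¹ ∈ B) :
    (κ.ker : Set G) = ⋃ j : ℕ, {x : G | t ^ j * x * (t ^ j)⁻¹ ∈ B} := by
  ext x
  simp only [SetLike.mem_coe, Set.mem_iUnion, Set.mem_ofPred_eq]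
  constructor
  · intro hx
    obtain ⟨m, hm⟩ := exists_band ht (fun b hb => hB hb) hgen x
    rw [nu_of_mem hx] at hm
    refine ⟨m, ?_⟩
    have h1 : Subgroup.closure (band t (B : Set G) m) ≤
        B.comap (MulAut.conj (t ^ m)).toMonoidHom := by
      rw [Subgroup.closure_le]
      rintro _ ⟨b, hb, j, hj, rfl⟩
      change t ^ m * (t ^ j * b * t ^ (-j)) * (t ^ m)⁻¹ ∈ B
      have hj' := abs_le.1 hj
      obtain ⟨k, hk⟩ := Int.eq_ofNat_of_zero_le (show 0 ≤ (m : ℤ) + j by omega)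
      have := asc_pow hasc k hb
      convert this using 1
      rw [← zpow_natCast t k, ← zpow_natCast t m, ← hk, zpow_add]
      group
    exact h1 hm
  · rintro ⟨j, hj⟩
    have := hB hj
    rw [mem_ker_iff, ex_mul, ex_mul, ex_inv] at this
    rw [mem_ker_iff]; omega

theorem ascend_dichotomy (ht : κ t = ofAdd 1) {B : Subgroup G} (hB : B ≤ κ.ker) (hfg : B.FG)
    (hgen : Subgroup.closure (insert t (B : Set G)) = ⊤) (hasc : ∀ b ∈ B, t * b * t⁻¹ ∈ B) :
    κ.ker.FG ∨ (Subgroup.map (MulAut.conj t).toMonoidHom B < B ∧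
      (κ.ker : Set G) = ⋃ j : ℕ, {x : G | t ^ j * x * (t ^ j)⁻¹ ∈ B}) := by
  have hu := ascend_union ht hB hgen hasc
  by_cases hlt : Subgroup.map (MulAut.conj t).toMonoidHom B < B
  · exact Or.inr ⟨hlt, hu⟩
  · left
    have hle : Subgroup.map (MulAut.conj t).toMonoidHom B ≤ B := by
      rintro _ ⟨b, hb, rfl⟩
      exact hasc b hb
    have heq : Subgroup.map (MulAut.conj t).toMonoidHom B = B := by
      by_contra hne
      exact hlt (lt_of_le_of_ne hle hne)
    have hinv : ∀ x, t * x * t⁻¹ ∈ B → x ∈ B := by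
      intro x hx
      rw [← heq] at hx
      obtain ⟨b, hb, hbx⟩ := hx
      have : t * b * t⁻¹ = t * x * t⁻¹ := hbx
      have : b = x := by simpa using this
      exact this ▸ hb
    have : κ.ker = B := by
      apply le_antisymm _ hB
      intro x hx
      have hx' : x ∈ (κ.ker : Set G) := hx
      rw [hu] at hx'
      simp only [Set.mem_iUnion, Set.mem_ofPred_eq] at hx'
      obtain ⟨j, hj⟩ := hx'
      induction j with
      | zero => simpa using hj
      | succ j ih =>
        apply ih
        apply hinv
        convert hj using 1
        rw [pow_succ']; group
    rw [this]; exact hfg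

theorem closure_insert_inv {B : Set G} (hgen : Subgroup.closure (insert t B) = ⊤) :
    Subgroup.closure (insert t⁻¹ B) = ⊤ := by
  rw [eq_top_iff, ← hgen, Subgroup.closure_le]
  rintro x (rfl | hx)
  · have : x⁻¹ ∈ Subgroup.closure (insert x⁻¹ B) := Subgroup.subset_closure (Or.inl rfl)
    simpa using inv_mem this
  · exact Subgroup.subset_closure (Or.inr hx)

theorem descend_dichotomy (ht : κ t = ofAdd 1) {B : Subgroup G} (hB : B ≤ κ.ker) (hfg : B.FG)
    (hgen : Subgroup.closure (insert t (B : Set G)) = ⊤) (hasc : ∀ b ∈ B, t⁻¹ * b * t ∈ B) :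
    κ.ker.FG ∨ (Subgroup.map (MulAut.conj t⁻¹).toMonoidHom B < B ∧
      (κ.ker : Set G) = ⋃ j : ℕ, {x : G | (t ^ j)⁻¹ * x * t ^ j ∈ B}) := by
  have hk : (κ⁻¹).ker = κ.ker := by ext x; simp [MonoidHom.mem_ker]
  have := ascend_dichotomy (κ := κ⁻¹) (t := t⁻¹) (by simp [ht]) (by rwa [hk]) hfg
    (closure_insert_inv hgen) (by simpa using hasc)
  rw [hk] at this
  simpa using this

theorem both_fg (ht : κ t = ofAdd 1) {B : Subgroup G} (hB : B ≤ κ.ker) (hfg : B.FG)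
    (hgen : Subgroup.closure (insert t (B : Set G)) = ⊤) (hasc : ∀ b ∈ B, t * b * t⁻¹ ∈ B)
    (hdesc : ∀ b ∈ B, t⁻¹ * b * t ∈ B) : κ.ker.FG := by
  rcases ascend_dichotomy ht hB hfg hgen hasc with h | ⟨h, -⟩
  · exact h
  · exfalso
    apply h.not_ge
    intro b hb
    refine ⟨t⁻¹ * b * t, hdesc b hb, ?_⟩
    change t * (t⁻¹ * b * t) * t⁻¹ = b
    group

end ascend

section core

open Classical in
/-- the inclusion of the base, extended by `1` -/
noncomputable def hf {Γ : Type*} [Group Γ] (τ : Γ) (B : Subgroup Γ) (p : Γ) :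
    HNNExtension B (assoc τ B) (assoc τ⁻¹ B) (assocEquiv τ B) :=
  if h : p ∈ B then HNNExtension.of ⟨p, h⟩ else 1

theorem hf_of {Γ : Type*} [Group Γ] {τ : Γ} {B : Subgroup Γ} {p : Γ} (h : p ∈ B) :
    hf τ B p = HNNExtension.of ⟨p, h⟩ := by
  simp [hf, h]

theorem hf_compat {Γ : Type*} [Group Γ] (τ : Γ) (B : Subgroup Γ) :
    Compat τ B (hf τ B) HNNExtension.t := by
  constructor
  · intro a ha b hb
    rw [hf_of ha, hf_of hb, hf_of (B.mul_mem ha hb), ← map_mul]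
    rfl
  · intro b hb hb'
    rw [hf_of hb, hf_of hb']
    exact (HNNExtension.equiv_eq_conj (φ := assocEquiv τ B) ⟨⟨b, hb⟩, hb'⟩).symm

universe u w

variable {G₁ : Type u} {G₂ : Type w} [Group G₁] [Group G₂]
  {κ₁ : G₁ →* Multiplicative ℤ} {κ₂ : G₂ →* Multiplicative ℤ} {t₁ : G₁} {t₂ : G₂}

theorem core [Group.IsFinitelyPresented G₁] [Group.IsFinitelyPresented G₂]
    (ht₁ : κ₁ t₁ = ofAdd 1) (ht₂ : κ₂ t₂ = ofAdd 1) (F₁ : Set G₁) (F₂ : Set G₂)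
    (hF₁ : F₁.Finite) (hF₂ : F₂.Finite) (hFk₁ : ∀ x ∈ F₁, x ∈ κ₁.ker) (hFk₂ : ∀ x ∈ F₂, x ∈ κ₂.ker)
    (hall : ∀ (E : Type (max u w)) [Group E] (g₁ : G₁ →* E) (g₂ : G₂ →* E), g₁ t₁ = g₂ t₂ →
      (∀ a ∈ F₁, ∀ b ∈ F₂, Commute (g₁ a) (g₂ b)) →
      ∀ a ∈ κ₁.ker, ∀ b ∈ κ₂.ker, Commute (g₁ a) (g₂ b)) :
    ∃ (B₁ : Subgroup G₁) (B₂ : Subgroup G₂), B₁ ≤ κ₁.ker ∧ B₂ ≤ κ₂.ker ∧ B₁.FG ∧ B₂.FG ∧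
      Subgroup.closure (insert t₁ (B₁ : Set G₁)) = ⊤ ∧
      Subgroup.closure (insert t₂ (B₂ : Set G₂)) = ⊤ ∧
      ((∀ b ∈ B₁, t₁ * b * t₁⁻¹ ∈ B₁) ∨ (∀ b ∈ B₂, t₂⁻¹ * b * t₂ ∈ B₂)) ∧
      ((∀ b ∈ B₂, t₂ * b * t₂⁻¹ ∈ B₂) ∨ (∀ b ∈ B₁, t₁⁻¹ * b * t₁ ∈ B₁)) := by
  obtain ⟨B₁, hB₁, hfg₁, hFB₁, hgen₁, hu₁⟩ := bieri_strebel.{max u w} ht₁ F₁ hF₁ hFk₁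
  obtain ⟨B₂, hB₂, hfg₂, hFB₂, hgen₂, hu₂⟩ := bieri_strebel.{max u w} ht₂ F₂ hF₂ hFk₂
  refine ⟨B₁, B₂, hB₁, hB₂, hfg₁, hfg₂, hgen₁, hgen₂, ?_⟩
  set τ : G₁ × G₂ := (t₁, t₂) with hτ
  set B : Subgroup (G₁ × G₂) := B₁.prod B₂ with hB
  have hc := hf_compat τ B
  have m₁ : ∀ {a}, a ∈ B₁ → (a, (1 : G₂)) ∈ B := fun ha => ⟨ha, B₂.one_mem⟩
  have m₂ : ∀ {a}, a ∈ B₂ → ((1 : G₁), a) ∈ B := fun ha => ⟨B₁.one_mem, ha⟩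
  have hc₁ : Compat t₁ B₁ (fun g => hf τ B (g, 1)) HNNExtension.t := by
    constructor
    · intro a ha b hb
      have := hc.1 _ (m₁ ha) _ (m₁ hb)
      simpa using this
    · intro b hb hb'
      have := hc.2 _ (m₁ hb) (by simpa [hτ] using m₁ hb')
      simpa [hτ] using this
  have hc₂ : Compat t₂ B₂ (fun g => hf τ B (1, g)) HNNExtension.t := by
    constructor
    · intro a ha b hb
      have := hc.1 _ (m₂ ha) _ (m₂ hb)
      simpa using this
    · intro b hb hb'
      have := hc.2 _ (m₂ hb) (by simpa [hτ] using m₂ hb')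
      simpa [hτ] using this
  obtain ⟨g₁, hg₁t, hg₁⟩ := hu₁ _ _ _ hc₁
  obtain ⟨g₂, hg₂t, hg₂⟩ := hu₂ _ _ _ hc₂
  have hcomm := hall _ g₁ g₂ (hg₁t.trans hg₂t.symm) (by
    intro a ha b hb
    rw [hg₁ a (hFB₁ ha), hg₂ b (hFB₂ hb)]
    have h1 := hc.1 _ (m₁ (hFB₁ ha)) _ (m₂ (hFB₂ hb))
    have h2 := hc.1 _ (m₂ (hFB₂ hb)) _ (m₁ (hFB₁ ha))
    simp only [Prod.mk_mul_mk, one_mul, mul_one] at h1 h2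
    exact h1.symm.trans h2)
  constructor
  · by_contra! hcon
    obtain ⟨⟨x, hx, hx'⟩, ⟨y, hy, hy'⟩⟩ := hcon
    have h1 := hcomm (t₁ * x * t₁⁻¹)
      (by simpa using conj_mem_ker (hB₁ hx) t₁ 1) y (hB₂ hy)
    rw [map_mul, map_mul, map_inv, hg₁t, hg₁ x hx, hg₂ y hy] at h1
    simp only [hf_of (m₁ hx), hf_of (m₂ hy)] at h1
    refine britton _ ?_ ?_ h1
    · intro h
      exact hx' h.1
    · intro h
      have := h.2
      apply hy'
      simpa [hτ] using this
  · by_contra! hcon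
    obtain ⟨⟨x, hx, hx'⟩, ⟨y, hy, hy'⟩⟩ := hcon
    have h1 := hcomm y (hB₁ hy) (t₂ * x * t₂⁻¹)
      (by simpa using conj_mem_ker (hB₂ hx) t₂ 1)
    rw [map_mul, map_mul, map_inv, hg₂t, hg₂ x hx, hg₁ y hy] at h1
    simp only [hf_of (m₂ hx), hf_of (m₁ hy)] at h1
    refine britton _ ?_ ?_ h1.symm
    · intro h
      exact hx' h.2
    · intro h
      have := h.1
      apply hy'
      simpa [hτ] using this

open Monoid
open scoped commutatorElement

/-- map from the free product to the direct product, with image the fibre product -/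
def Phi (κ₁ : G₁ →* Multiplicative ℤ) (κ₂ : G₂ →* Multiplicative ℤ) (t₁ : G₁) (t₂ : G₂) :
    Coprod G₁ G₂ →* G₁ × G₂ :=
  Coprod.lift (MonoidHom.prod (MonoidHom.id G₁) ((zpowersHom G₂ t₂).comp κ₁))
    (MonoidHom.prod ((zpowersHom G₁ t₁).comp κ₂) (MonoidHom.id G₂))

theorem Phi_inl (g : G₁) : Phi κ₁ κ₂ t₁ t₂ (Coprod.inl g) = (g, t₂ ^ ex κ₁ g) := by
  simp [Phi, ex, zpowersHom_apply]

theorem Phi_inr (g : G₂) : Phi κ₁ κ₂ t₁ t₂ (Coprod.inr g) = (t₁ ^ ex κ₂ g, g) := by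
  simp [Phi, ex, zpowersHom_apply]

theorem Phi_ex (ht₁ : κ₁ t₁ = ofAdd 1) (ht₂ : κ₂ t₂ = ofAdd 1) (p : Coprod G₁ G₂) :
    ex κ₁ (Phi κ₁ κ₂ t₁ t₂ p).1 = ex κ₂ (Phi κ₁ κ₂ t₁ t₂ p).2 := by
  induction p using Coprod.induction_on with
  | inl g => simp [Phi_inl, ex_zpow, ex_t ht₂]
  | inr g => simp [Phi_inr, ex_zpow, ex_t ht₁]
  | mul a b ha hb => simp [ex_mul, ha, hb]

theorem Phi_range (ht₁ : κ₁ t₁ = ofAdd 1) (ht₂ : κ₂ t₂ = ofAdd 1) (p : G₁ × G₂) :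
    p ∈ (Phi κ₁ κ₂ t₁ t₂).range ↔ ex κ₁ p.1 = ex κ₂ p.2 := by
  constructor
  · rintro ⟨q, rfl⟩
    exact Phi_ex ht₁ ht₂ q
  · intro h
    refine ⟨Coprod.inr (nu κ₂ t₂ p.2) * Coprod.inl p.1, ?_⟩
    rw [map_mul, Phi_inl, Phi_inr, (mem_ker_iff _).1 (nu_mem ht₂ p.2)]
    ext
    · simp
    · simp only [Prod.mk_mul_mk, h, nu_mul_zpow]

theorem q_eq (ht₁ : κ₁ t₁ = ofAdd 1) (ht₂ : κ₂ t₂ = ofAdd 1) {E : Type*} [Group E]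
    (q : Coprod G₁ G₂ →* E) (hqt : q (Coprod.inl t₁) = q (Coprod.inr t₂))
    (hqc : ∀ a ∈ κ₁.ker, ∀ b ∈ κ₂.ker, Commute (q (Coprod.inl a)) (q (Coprod.inr b)))
    (p : Coprod G₁ G₂) :
    q p = q (Coprod.inr (nu κ₂ t₂ (Phi κ₁ κ₂ t₁ t₂ p).2)) *
      q (Coprod.inl (Phi κ₁ κ₂ t₁ t₂ p).1) := by
  induction p using Coprod.induction_on with
  | inl g => simp [Phi_inl, nu, ex_zpow, ex_t ht₂]
  | inr g =>
    rw [Phi_inr, map_zpow, map_zpow, hqt, ← map_zpow, ← map_zpow, ← map_mul, ← map_mul,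
      nu_mul_zpow]
  | mul a b ha hb =>
    have hk := Phi_ex ht₁ ht₂ a
    rw [map_mul, ha, hb, map_mul, Prod.fst_mul, Prod.snd_mul, nu_mul]
    set a₁ := (Phi κ₁ κ₂ t₁ t₂ a).1
    set a₂ := (Phi κ₁ κ₂ t₁ t₂ a).2
    set b₁ := (Phi κ₁ κ₂ t₁ t₂ b).1
    set b₂ := (Phi κ₁ κ₂ t₁ t₂ b).2
    have h1 := hqc (nu κ₁ t₁ a₁) (nu_mem ht₁ a₁)
      (t₂ ^ ex κ₂ a₂ * nu κ₂ t₂ b₂ * t₂ ^ (- ex κ₂ a₂)) (conj_mem_ker (nu_mem ht₂ b₂) _ _)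
    have h2 : q (Coprod.inl a₁) = q (Coprod.inl (nu κ₁ t₁ a₁)) * q (Coprod.inr t₂) ^ ex κ₂ a₂ := by
      rw [← hqt, ← hk, ← map_zpow, ← map_zpow, ← map_mul, ← map_mul, nu_mul_zpow]
    have h3 := h1.eq
    simp only [map_mul, map_zpow] at h3 ⊢
    rw [h2]
    rw [← mul_assoc, ← mul_assoc, mul_assoc (q (Coprod.inr (nu κ₂ t₂ a₂)))]
    simp only [mul_assoc] at h3 ⊢
    congr 1
    rw [← mul_assoc (q (Coprod.inl (nu κ₁ t₁ a₁)))]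
    have h4 := congrArg (· * (q (Coprod.inr t₂) ^ ex κ₂ a₂ * q (Coprod.inl b₁))) h3
    simp only [mul_assoc, zpow_neg, inv_mul_cancel_left] at h4
    simp only [mul_assoc, zpow_neg]
    exact h4

theorem Phi_ker_le (ht₁ : κ₁ t₁ = ofAdd 1) (ht₂ : κ₂ t₂ = ofAdd 1) {E : Type*} [Group E]
    (q : Coprod G₁ G₂ →* E) (hqt : q (Coprod.inl t₁) = q (Coprod.inr t₂))
    (hqc : ∀ a ∈ κ₁.ker, ∀ b ∈ κ₂.ker, Commute (q (Coprod.inl a)) (q (Coprod.inr b))) :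
    (Phi κ₁ κ₂ t₁ t₂).ker ≤ q.ker := by
  intro p hp
  rw [MonoidHom.mem_ker] at hp ⊢
  rw [q_eq ht₁ ht₂ q hqt hqc, hp]
  simp [nu, ex_one]

/-- relators -/
def rels (t₁ : G₁) (t₂ : G₂) (X₁ : Set G₁) (X₂ : Set G₂) : Set (Coprod G₁ G₂) :=
  insert (Coprod.inl t₁ * (Coprod.inr t₂)⁻¹)
    (Set.image2 (fun a b => ⁅(Coprod.inl a : Coprod G₁ G₂), Coprod.inr b⁆) X₁ X₂)

theorem rels_le_ker (ht₁ : κ₁ t₁ = ofAdd 1) (ht₂ : κ₂ t₂ = ofAdd 1) {X₁ : Set G₁} {X₂ : Set G₂}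
    (h₁ : ∀ x ∈ X₁, x ∈ κ₁.ker) (h₂ : ∀ x ∈ X₂, x ∈ κ₂.ker) :
    Subgroup.normalClosure (rels t₁ t₂ X₁ X₂) ≤ (Phi κ₁ κ₂ t₁ t₂).ker := by
  apply Subgroup.normalClosure_le_normal
  rintro _ (rfl | ⟨a, ha, b, hb, rfl⟩)
  · change Phi κ₁ κ₂ t₁ t₂ _ = 1
    rw [map_mul, map_inv, Phi_inl, Phi_inr, ex_t ht₁, ex_t ht₂]
    simp
  · change Phi κ₁ κ₂ t₁ t₂ _ = 1
    rw [map_commutatorElement, Phi_inl, Phi_inr, (mem_ker_iff _).1 (h₁ a ha),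
      (mem_ker_iff _).1 (h₂ b hb)]
    simp [commutatorElement_def]

theorem kills_rels {X₁ : Set G₁} {X₂ : Set G₂} {E : Type*} [Group E] (q : Coprod G₁ G₂ →* E) :
    rels t₁ t₂ X₁ X₂ ⊆ q.ker ↔ q (Coprod.inl t₁) = q (Coprod.inr t₂) ∧
      ∀ a ∈ X₁, ∀ b ∈ X₂, Commute (q (Coprod.inl a)) (q (Coprod.inr b)) := by
  have e1 : (Coprod.inl t₁ * (Coprod.inr t₂)⁻¹ : Coprod G₁ G₂) ∈ q.ker ↔
      q (Coprod.inl t₁) = q (Coprod.inr t₂) := by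
    rw [MonoidHom.mem_ker, map_mul, map_inv, mul_inv_eq_one]
  have e2 : ∀ a b, ⁅(Coprod.inl a : Coprod G₁ G₂), Coprod.inr b⁆ ∈ q.ker ↔
      Commute (q (Coprod.inl a)) (q (Coprod.inr b)) := by
    intro a b
    rw [MonoidHom.mem_ker, map_commutatorElement, commutatorElement_eq_one_iff_commute]
  rw [rels, Set.insert_subset_iff, Set.image2_subset_iff]
  simp only [SetLike.mem_coe, e1, e2]

/-- If finitely many commutation relations suffice, the fibre product is finitely presented. -/
theorem fp_of_finite [Group.IsFinitelyPresented G₁] [Group.IsFinitelyPresented G₂]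
    (ht₁ : κ₁ t₁ = ofAdd 1) (ht₂ : κ₂ t₂ = ofAdd 1) (X₁ : Set G₁) (X₂ : Set G₂)
    (hX₁ : X₁.Finite) (hX₂ : X₂.Finite) (hk₁ : ∀ x ∈ X₁, x ∈ κ₁.ker) (hk₂ : ∀ x ∈ X₂, x ∈ κ₂.ker)
    (hall : ∀ (E : Type (max u w)) [Group E] (g₁ : G₁ →* E) (g₂ : G₂ →* E), g₁ t₁ = g₂ t₂ →
      (∀ a ∈ X₁, ∀ b ∈ X₂, Commute (g₁ a) (g₂ b)) →
      ∀ a ∈ κ₁.ker, ∀ b ∈ κ₂.ker, Commute (g₁ a) (g₂ b)) :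
    Group.IsFinitelyPresented (Phi κ₁ κ₂ t₁ t₂).range := by
  refine Group.IsFinitelyPresented.of_surjective (Phi κ₁ κ₂ t₁ t₂).rangeRestrict
    (MonoidHom.rangeRestrict_surjective _) ?_
  rw [MonoidHom.ker_rangeRestrict]
  refine ⟨rels t₁ t₂ X₁ X₂, (hX₁.image2 _ hX₂).insert _, ?_⟩
  refine le_antisymm (rels_le_ker ht₁ ht₂ hk₁ hk₂) ?_
  let q := QuotientGroup.mk' (Subgroup.normalClosure (rels t₁ t₂ X₁ X₂))
  have hq : q.ker = Subgroup.normalClosure (rels t₁ t₂ X₁ X₂) := QuotientGroup.ker_mk' _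
  have h1 : rels t₁ t₂ X₁ X₂ ⊆ q.ker := by rw [hq]; exact Subgroup.subset_normalClosure
  obtain ⟨h2, h3⟩ := (kills_rels q).1 h1
  rw [← hq]
  exact Phi_ker_le ht₁ ht₂ q h2
    (hall _ (q.comp Coprod.inl) (q.comp Coprod.inr) h2 h3)

theorem finite_of_fp [Group.IsFinitelyPresented G₁] [Group.IsFinitelyPresented G₂]
    (ht₁ : κ₁ t₁ = ofAdd 1) (ht₂ : κ₂ t₂ = ofAdd 1)
    [Group.IsFinitelyPresented (Phi κ₁ κ₂ t₁ t₂).range] :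
    ∃ (F₁ : Set G₁) (F₂ : Set G₂), F₁.Finite ∧ F₂.Finite ∧ (∀ x ∈ F₁, x ∈ κ₁.ker) ∧
      (∀ x ∈ F₂, x ∈ κ₂.ker) ∧
    (∀ (E : Type (max u w)) [Group E] (g₁ : G₁ →* E) (g₂ : G₂ →* E), g₁ t₁ = g₂ t₂ →
      (∀ a ∈ F₁, ∀ b ∈ F₂, Commute (g₁ a) (g₂ b)) →
      ∀ a ∈ κ₁.ker, ∀ b ∈ κ₂.ker, Commute (g₁ a) (g₂ b)) := by
  have h1 := ker_fng (Phi κ₁ κ₂ t₁ t₂).rangeRestrict (MonoidHom.rangeRestrict_surjective _)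
  rw [MonoidHom.ker_rangeRestrict] at h1
  let T := rels t₁ t₂ (κ₁.ker : Set G₁) (κ₂.ker : Set G₂)
  have hT : Subgroup.normalClosure T = (Phi κ₁ κ₂ t₁ t₂).ker := by
    refine le_antisymm (rels_le_ker ht₁ ht₂ (fun _ h => h) (fun _ h => h)) ?_
    let q := QuotientGroup.mk' (Subgroup.normalClosure T)
    have hq : q.ker = Subgroup.normalClosure T := QuotientGroup.ker_mk' _
    have h1 : T ⊆ q.ker := by rw [hq]; exact Subgroup.subset_normalClosure
    obtain ⟨h2, h3⟩ := (kills_rels q).1 h1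
    rw [← hq]
    exact Phi_ker_le ht₁ ht₂ q h2 h3
  rw [← hT] at h1
  obtain ⟨T', hT'T, hT'f, hle⟩ := finite_ncl T h1
  have hch : ∀ s : T', ∃ p : G₁ × G₂, p.1 ∈ κ₁.ker ∧ p.2 ∈ κ₂.ker ∧
      ((s : Coprod G₁ G₂) = Coprod.inl t₁ * (Coprod.inr t₂)⁻¹ ∨
        (s : Coprod G₁ G₂) = ⁅(Coprod.inl p.1 : Coprod G₁ G₂), Coprod.inr p.2⁆) := by
    rintro ⟨s, hs⟩
    rcases hT'T hs with h | ⟨a, ha, b, hb, h⟩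
    · exact ⟨1, one_mem _, one_mem _, Or.inl h⟩
    · exact ⟨(a, b), ha, hb, Or.inr h.symm⟩
  choose p hp₁ hp₂ hp using hch
  have : Finite T' := hT'f
  refine ⟨Set.range fun s => (p s).1, Set.range fun s => (p s).2, Set.finite_range _,
    Set.finite_range _, ?_, ?_, ?_⟩
  · rintro _ ⟨s, rfl⟩; exact hp₁ s
  · rintro _ ⟨s, rfl⟩; exact hp₂ s
  · intro E _ g₁ g₂ hg hcomm
    let q : Coprod G₁ G₂ →* E := Coprod.lift g₁ g₂
    have hq₁ : ∀ a, q (Coprod.inl a) = g₁ a := fun a => Coprod.lift_apply_inl _ _ _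
    have hq₂ : ∀ a, q (Coprod.inr a) = g₂ a := fun a => Coprod.lift_apply_inr _ _ _
    have h2 : T' ⊆ q.ker := by
      intro s hs
      have h3 : rels t₁ t₂ (Set.range fun s => (p s).1) (Set.range fun s => (p s).2) ⊆ q.ker := by
        rw [kills_rels]
        simp only [hq₁, hq₂]
        exact ⟨hg, hcomm⟩
      apply h3
      rcases hp ⟨s, hs⟩ with h | h
      · exact Or.inl h
      · exact Or.inr ⟨_, ⟨⟨s, hs⟩, rfl⟩, _, ⟨⟨s, hs⟩, rfl⟩, h.symm⟩
    have h4 : T ⊆ q.ker := fun x hx =>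
      (Subgroup.normalClosure_le_normal h2) (hle (Subgroup.subset_normalClosure hx))
    have h5 := ((kills_rels q).1 h4).2
    simp only [hq₁, hq₂] at h5
    exact h5

end core

section suff

theorem commute_closure {G₁ G₂ E : Type*} [Group G₁] [Group G₂] [Group E]
    (g₁ : G₁ →* E) (g₂ : G₂ →* E) {X₁ : Set G₁} {X₂ : Set G₂}
    (h : ∀ a ∈ X₁, ∀ b ∈ X₂, Commute (g₁ a) (g₂ b)) :
    ∀ a ∈ Subgroup.closure X₁, ∀ b ∈ Subgroup.closure X₂, Commute (g₁ a) (g₂ b) := by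
  have h1 : ∀ a ∈ Subgroup.closure X₁, ∀ b ∈ X₂, Commute (g₁ a) (g₂ b) := by
    intro a ha b hb
    induction ha using Subgroup.closure_induction with
    | mem x hx => exact h x hx b hb
    | one => rw [map_one]; exact Commute.one_left _
    | mul x y _ _ hx hy => rw [map_mul]; exact hx.mul_left hy
    | inv x _ hx => rw [map_inv]; exact hx.inv_left
  intro a ha b hb
  induction hb using Subgroup.closure_induction with
  | mem x hx => exact h1 a ha x hx
  | one => rw [map_one]; exact Commute.one_right _
  | mul x y _ _ hx hy => rw [map_mul]; exact hx.mul_right hy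
  | inv x _ hx => rw [map_inv]; exact hx.inv_right

theorem exists_gens {G : Type*} [Group G] [hG : Group.IsFinitelyPresented G]
    {κ : G →* Multiplicative ℤ} {t : G} (ht : κ t = ofAdd 1) :
    ∃ X : Set G, X.Finite ∧ (∀ x ∈ X, x ∈ κ.ker) ∧ Subgroup.closure (insert t X) = ⊤ := by
  obtain ⟨B, hB, hfg, -, hgen, -⟩ := bieri_strebel.{0} (κ := κ) ht ∅ Set.finite_empty (by simp)
  obtain ⟨X, hX, hXf⟩ := (Subgroup.fg_iff _).1 hfg
  refine ⟨X, hXf, fun x hx => hB (hX ▸ Subgroup.subset_closure hx), ?_⟩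
  rw [eq_top_iff, ← hgen, Subgroup.closure_le]
  rintro x (rfl | hx)
  · exact Subgroup.subset_closure (Set.mem_insert _ _)
  · have hx' : x ∈ B := hx
    rw [← hX] at hx'
    exact Subgroup.closure_mono (Set.subset_insert _ _) hx'

theorem suff_one {G₁ G₂ E : Type*} [Group G₁] [Group G₂] [Group E]
    {κ₁ : G₁ →* Multiplicative ℤ} {κ₂ : G₂ →* Multiplicative ℤ} {t₁ : G₁} {t₂ : G₂}
    (ht₂ : κ₂ t₂ = ofAdd 1) {X₁ : Set G₁} {X₂ : Set G₂}
    (hX₁ : Subgroup.closure X₁ = κ₁.ker) (hk₂ : ∀ x ∈ X₂, x ∈ κ₂.ker)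
    (hgen : Subgroup.closure (insert t₂ X₂) = ⊤)
    (g₁ : G₁ →* E) (g₂ : G₂ →* E) (hg : g₁ t₁ = g₂ t₂)
    (h : ∀ a ∈ X₁, ∀ b ∈ X₂, Commute (g₁ a) (g₂ b)) :
    ∀ a ∈ κ₁.ker, ∀ b ∈ κ₂.ker, Commute (g₁ a) (g₂ b) := by
  intro a ha b hb
  obtain ⟨m, hm⟩ := exists_band ht₂ hk₂ hgen b
  rw [nu_of_mem hb] at hm
  rw [← hX₁] at ha
  refine commute_closure g₁ g₂ ?_ a ha b hm
  rintro x hx _ ⟨y, hy, j, -, rfl⟩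
  have hx' : t₁ ^ (-j) * x * t₁ ^ (- -j) ∈ κ₁.ker :=
    conj_mem_ker (hX₁ ▸ Subgroup.subset_closure hx) t₁ (-j)
  rw [← hX₁] at hx'
  have h1 := commute_closure g₁ g₂ h _ hx' y (Subgroup.subset_closure hy)
  have h2 := (Commute.conj_iff (g₂ t₂ ^ j)).2 h1
  simp only [map_mul, map_zpow, hg] at h2 ⊢
  convert h2 using 1 <;> group

theorem suff_two {G₁ G₂ E : Type*} [Group G₁] [Group G₂] [Group E]
    {N₁ : Subgroup G₁} {N₂ : Subgroup G₂} {t₁ : G₁} {t₂ : G₂}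
    {X₁ : Set G₁} {X₂ : Set G₂}
    (ha₁ : Subgroup.map (MulAut.conj t₁).toMonoidHom (Subgroup.closure X₁) < Subgroup.closure X₁)
    (ha₂ : Subgroup.map (MulAut.conj t₂).toMonoidHom (Subgroup.closure X₂) < Subgroup.closure X₂)
    (hu₁ : (N₁ : Set G₁) = ⋃ j : ℕ, {x : G₁ | t₁ ^ j * x * (t₁ ^ j)⁻¹ ∈ Subgroup.closure X₁})
    (hu₂ : (N₂ : Set G₂) = ⋃ j : ℕ, {x : G₂ | t₂ ^ j * x * (t₂ ^ j)⁻¹ ∈ Subgroup.closure X₂})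
    (g₁ : G₁ →* E) (g₂ : G₂ →* E) (hg : g₁ t₁ = g₂ t₂)
    (h : ∀ a ∈ X₁, ∀ b ∈ X₂, Commute (g₁ a) (g₂ b)) :
    ∀ a ∈ N₁, ∀ b ∈ N₂, Commute (g₁ a) (g₂ b) := by
  intro a ha b hb
  rw [← SetLike.mem_coe, hu₁] at ha
  rw [← SetLike.mem_coe, hu₂] at hb
  simp only [Set.mem_iUnion, Set.mem_ofPred_eq] at ha hb
  obtain ⟨i, hi⟩ := ha
  obtain ⟨j, hj⟩ := hb
  have m₁ := asc_pow (fun b hb => ha₁.le ⟨b, hb, rfl⟩) j hi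
  have m₂ := asc_pow (fun b hb => ha₂.le ⟨b, hb, rfl⟩) i hj
  have h1 := commute_closure g₁ g₂ h _ m₁ _ m₂
  rw [← Commute.conj_iff (g₂ t₂ ^ (i + j))]
  simp only [map_mul, map_pow, map_inv, hg] at h1
  convert h1 using 1 <;> (simp only [← zpow_natCast]; push_cast; group)

end suff

end FibreCorank

/-- Asymmetric co-rank one criterion: for `G₁ = N₁ ⋊ ⟨t₁⟩` and `G₂ = N₂ ⋊ ⟨t₂⟩`
finitely presented (with `⟨tᵢ⟩` infinite cyclic), the fibre product associated to
`t₁N₁ ↦ t₂N₂` is finitely presented iff either some `Nᵢ` is finitely generated, or both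
`Gᵢ` are strict ascending HNN-extensions with finitely generated bases `Bᵢ ≤ Nᵢ`, with the
same direction of ascent. -/
theorem fibre_product_semidirect_corank_one {G₁ G₂ : Type*} [Group G₁] [Group G₂]
    (hfp₁ : FinitelyPresentedGroup G₁) (hfp₂ : FinitelyPresentedGroup G₂)
    (N₁ : Subgroup G₁) (N₂ : Subgroup G₂) [N₁.Normal] [N₂.Normal]
    (t₁ : G₁) (t₂ : G₂) (ht₁ : ¬ IsOfFinOrder t₁) (ht₂ : ¬ IsOfFinOrder t₂)
    (hsup₁ : N₁ ⊔ Subgroup.zpowers t₁ = ⊤) (hinf₁ : N₁ ⊓ Subgroup.zpowers t₁ = ⊥)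
    (hsup₂ : N₂ ⊔ Subgroup.zpowers t₂ = ⊤) (hinf₂ : N₂ ⊓ Subgroup.zpowers t₂ = ⊥)
    (H : Subgroup (G₁ × G₂))
    (hH : ∀ p : G₁ × G₂, p ∈ H ↔
      ∃ k : ℤ, p.1 * (t₁ ^ k)⁻¹ ∈ N₁ ∧ p.2 * (t₂ ^ k)⁻¹ ∈ N₂) :
    FinitelyPresentedGroup ↥H ↔
      ((N₁.FG ∨ N₂.FG) ∨
        ∃ (B₁ : Subgroup G₁) (B₂ : Subgroup G₂),
          B₁ ≤ N₁ ∧ B₂ ≤ N₂ ∧ B₁.FG ∧ B₂.FG ∧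
          ((Subgroup.map (MulAut.conj t₁).toMonoidHom B₁ < B₁ ∧
            Subgroup.map (MulAut.conj t₂).toMonoidHom B₂ < B₂ ∧
            (N₁ : Set G₁) = ⋃ j : ℕ, {x : G₁ | t₁ ^ j * x * (t₁ ^ j)⁻¹ ∈ B₁} ∧
            (N₂ : Set G₂) = ⋃ j : ℕ, {x : G₂ | t₂ ^ j * x * (t₂ ^ j)⁻¹ ∈ B₂}) ∨
           (Subgroup.map (MulAut.conj t₁⁻¹).toMonoidHom B₁ < B₁ ∧
            Subgroup.map (MulAut.conj t₂⁻¹).toMonoidHom B₂ < B₂ ∧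
            (N₁ : Set G₁) = ⋃ j : ℕ, {x : G₁ | (t₁ ^ j)⁻¹ * x * t₁ ^ j ∈ B₁} ∧
            (N₂ : Set G₂) = ⋃ j : ℕ, {x : G₂ | (t₂ ^ j)⁻¹ * x * t₂ ^ j ∈ B₂}))) := by
  open FibreCorank in
  classical
  obtain ⟨κ₁, hκ₁, rfl⟩ := exists_kappa N₁ t₁ ht₁ hsup₁ hinf₁
  obtain ⟨κ₂, hκ₂, rfl⟩ := exists_kappa N₂ t₂ ht₂ hsup₂ hinf₂
  have := (fp_iff G₁).1 hfp₁
  have := (fp_iff G₂).1 hfp₂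
  have hHr : H = (Phi κ₁ κ₂ t₁ t₂).range := by
    ext p
    rw [hH, Phi_range hκ₁ hκ₂]
    simp only [mem_ker_iff, ex_mul, ex_inv, ex_zpow, ex_t hκ₁, ex_t hκ₂]
    constructor
    · rintro ⟨k, h1, h2⟩; omega
    · intro h; exact ⟨ex κ₁ p.1, by omega, by omega⟩
  subst hHr
  rw [fp_iff]
  constructor
  · intro hfp
    obtain ⟨F₁, F₂, hF₁, hF₂, hk₁, hk₂, hall⟩ := finite_of_fp hκ₁ hκ₂
    obtain ⟨B₁, B₂, hB₁, hB₂, hfg₁, hfg₂, hgen₁, hgen₂, h1, h2⟩ :=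
      core hκ₁ hκ₂ F₁ F₂ hF₁ hF₂ hk₁ hk₂ hall
    rcases h1 with h1 | h1 <;> rcases h2 with h2 | h2
    · rcases ascend_dichotomy hκ₁ hB₁ hfg₁ hgen₁ h1 with h | ⟨h, h'⟩
      · exact Or.inl (Or.inl h)
      rcases ascend_dichotomy hκ₂ hB₂ hfg₂ hgen₂ h2 with k | ⟨k, k'⟩
      · exact Or.inl (Or.inr k)
      exact Or.inr ⟨B₁, B₂, hB₁, hB₂, hfg₁, hfg₂, Or.inl ⟨h, k, h', k'⟩⟩
    · exact Or.inl (Or.inl (both_fg hκ₁ hB₁ hfg₁ hgen₁ h1 h2))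
    · exact Or.inl (Or.inr (both_fg hκ₂ hB₂ hfg₂ hgen₂ h2 h1))
    · rcases descend_dichotomy hκ₁ hB₁ hfg₁ hgen₁ h2 with h | ⟨h, h'⟩
      · exact Or.inl (Or.inl h)
      rcases descend_dichotomy hκ₂ hB₂ hfg₂ hgen₂ h1 with k | ⟨k, k'⟩
      · exact Or.inl (Or.inr k)
      exact Or.inr ⟨B₁, B₂, hB₁, hB₂, hfg₁, hfg₂, Or.inr ⟨h, k, h', k'⟩⟩
  · rintro ((h | h) | ⟨B₁, B₂, hB₁, hB₂, hfg₁, hfg₂, h⟩)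
    · obtain ⟨X₁, hX₁, hXf₁⟩ := (Subgroup.fg_iff _).1 h
      obtain ⟨X₂, hXf₂, hk₂, hgen₂⟩ := exists_gens hκ₂
      exact fp_of_finite hκ₁ hκ₂ X₁ X₂ hXf₁ hXf₂
        (fun x hx => hX₁ ▸ Subgroup.subset_closure hx) hk₂
        (fun E _ g₁ g₂ hg hc => suff_one hκ₂ hX₁ hk₂ hgen₂ g₁ g₂ hg hc)
    · obtain ⟨X₂, hX₂, hXf₂⟩ := (Subgroup.fg_iff _).1 h
      obtain ⟨X₁, hXf₁, hk₁, hgen₁⟩ := exists_gens hκ₁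
      exact fp_of_finite hκ₁ hκ₂ X₁ X₂ hXf₁ hXf₂ hk₁
        (fun x hx => hX₂ ▸ Subgroup.subset_closure hx)
        (fun E _ g₁ g₂ hg hc a ha b hb => (suff_one hκ₁ hX₂ hk₁ hgen₁ g₂ g₁ hg.symm
          (fun a ha b hb => (hc b hb a ha).symm) b hb a ha).symm)
    · obtain ⟨X₁, rfl, hXf₁⟩ := (Subgroup.fg_iff _).1 hfg₁
      obtain ⟨X₂, rfl, hXf₂⟩ := (Subgroup.fg_iff _).1 hfg₂
      refine fp_of_finite hκ₁ hκ₂ X₁ X₂ hXf₁ hXf₂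
        (fun x hx => hB₁ (Subgroup.subset_closure hx))
        (fun x hx => hB₂ (Subgroup.subset_closure hx)) ?_
      intro E _ g₁ g₂ hg hc
      rcases h with ⟨a₁, a₂, u₁, u₂⟩ | ⟨a₁, a₂, u₁, u₂⟩
      · exact suff_two a₁ a₂ u₁ u₂ g₁ g₂ hg hc
      · exact suff_two a₁ a₂ (by simpa using u₁) (by simpa using u₂) g₁ g₂
          (by rw [map_inv, map_inv, hg]) hc
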